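/- Let T be a self-adjoint operator on a Hilbert space H with no eigenvalues, and let C be a bounded operator such that C(T + i)⁻¹ is compact. Then for every Φ ∈ H, (1/(2T₀))∫_{−T₀}^{T₀} ‖C e^{−itT}Φ‖² dt → 0 as T₀ → ∞. -/

import Mathlib

open Filter Topology

section TimeMean

variable {E : Type*} [NormedAddCommGroup E] [NormedSpace ℝ E]

/-- The mean of `f` over the interval `[-r, r]`. -/
noncomputable def timeMean (f : ℝ → E) (r : ℝ) : E :=
  (1 / (2 * r)) • ∫ t in (-r)..r, f t

lemma timeMean_add {f g : ℝ → E} (hf : Continuous f) (hg : Continuous g) :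
    timeMean (fun t => f t + g t) = timeMean f + timeMean g := by
  ext r
  simp only [timeMean, Pi.add_apply]
  rw [intervalIntegral.integral_add (hf.intervalIntegrable _ _) (hg.intervalIntegrable _ _),
    smul_add]

lemma timeMean_finsetSum {ι : Type*} (s : Finset ι) {f : ι → ℝ → E}
    (hf : ∀ i ∈ s, Continuous (f i)) (r : ℝ) :
    timeMean (fun t => ∑ i ∈ s, f i t) r = ∑ i ∈ s, timeMean (f i) r := by
  simp only [timeMean]
  rw [intervalIntegral.integral_finsetSum fun i hi => (hf i hi).intervalIntegrable _ _,
    Finset.smul_sum]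

lemma timeMean_smul {𝕜 : Type*} [RCLike 𝕜] [NormedSpace 𝕜 E] [SMulCommClass ℝ 𝕜 E]
    (c : 𝕜) (f : ℝ → E) :
    timeMean (fun t => c • f t) = c • timeMean f := by
  ext r
  simp only [timeMean, Pi.smul_apply]
  rw [intervalIntegral.integral_smul, smul_comm]

lemma timeMean_const [CompleteSpace E] (c : E) {r : ℝ} (hr : 0 < r) :
    timeMean (fun _ => c) r = c := by
  simp only [timeMean, intervalIntegral.integral_const, smul_smul]
  rw [show 1 / (2 * r) * (r - -r) = 1 by field_simp; ring, one_smul]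

lemma norm_timeMean_le {f : ℝ → E} {M : ℝ} (hM : ∀ t, ‖f t‖ ≤ M) {r : ℝ} (hr : 0 < r) :
    ‖timeMean f r‖ ≤ M := by
  have h := intervalIntegral.norm_integral_le_of_norm_le_const (a := -r) (b := r)
    (fun t _ => hM t)
  rw [timeMean, norm_smul, Real.norm_of_nonneg (by positivity)]
  calc 1 / (2 * r) * ‖∫ t in (-r)..r, f t‖ ≤ 1 / (2 * r) * (M * |r - -r|) := by gcongr
    _ = M := by rw [abs_of_pos (by linarith)]; field_simp; ring

lemma timeMean_mono {f g : ℝ → ℝ} (hf : Continuous f) (hg : Continuous g)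
    (hfg : ∀ t, f t ≤ g t) {r : ℝ} (hr : 0 < r) : timeMean f r ≤ timeMean g r := by
  simp only [timeMean, smul_eq_mul]
  gcongr
  exact intervalIntegral.integral_mono (by linarith) (hf.intervalIntegrable _ _)
    (hg.intervalIntegrable _ _) hfg

lemma timeMean_nonneg {f : ℝ → ℝ} (hf : ∀ t, 0 ≤ f t) {r : ℝ} (hr : 0 < r) :
    0 ≤ timeMean f r :=
  smul_nonneg (by positivity) (intervalIntegral.integral_nonneg (by linarith) fun t _ => hf t)

lemma timeMean_ofReal (f : ℝ → ℝ) (r : ℝ) :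
    timeMean (fun t => (f t : ℂ)) r = ((timeMean f r : ℝ) : ℂ) := by
  simp only [timeMean, intervalIntegral.integral_ofReal, smul_eq_mul, Complex.ofReal_mul,
    Complex.real_smul]

/-- Time means of bounded functions are asymptotically invariant under translations. -/
lemma tendsto_timeMean_comp_add_sub {f : ℝ → E} (hf : Continuous f) {M : ℝ}
    (hM : ∀ t, ‖f t‖ ≤ M) (s : ℝ) :
    Tendsto (fun r => timeMean (fun t => f (t + s)) r - timeMean f r) atTop (𝓝 0) := by
  have hbound : ∀ᶠ r : ℝ in atTop,
      ‖timeMean (fun t => f (t + s)) r - timeMean f r‖ ≤ (M * |s|) * r⁻¹ := by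
    filter_upwards [eventually_gt_atTop 0] with r hr
    simp only [timeMean]
    rw [← smul_sub, intervalIntegral.integral_comp_add_right,
      intervalIntegral.integral_interval_sub_interval_comm (hf.intervalIntegrable _ _)
        (hf.intervalIntegrable _ _) (hf.intervalIntegrable _ _), norm_smul,
      Real.norm_of_nonneg (by positivity)]
    have h1 := intervalIntegral.norm_integral_le_of_norm_le_const (a := -r + s) (b := -r)
      (fun t _ => hM t)
    have h2 := intervalIntegral.norm_integral_le_of_norm_le_const (a := r + s) (b := r)
      (fun t _ => hM t)
    rw [show -r - (-r + s) = -s by ring, abs_neg] at h1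
    rw [show r - (r + s) = -s by ring, abs_neg] at h2
    calc _ ≤ 1 / (2 * r) * (M * |s| + M * |s|) := by
          gcongr
          exact (norm_sub_le _ _).trans (add_le_add h1 h2)
      _ = (M * |s|) * r⁻¹ := by field_simp; ring
  refine squeeze_zero_norm' hbound ?_
  simpa using tendsto_inv_atTop_zero.const_mul (M * |s|)

/-- A nonnegative function dominated, up to arbitrarily small constants, by functions whose time
means vanish asymptotically has asymptotically vanishing time means. -/
lemma tendsto_timeMean_zero_of_forall_le_add {f : ℝ → ℝ} (hf : Continuous f) (hf0 : ∀ t, 0 ≤ f t)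
    (h : ∀ ε > 0, ∃ g : ℝ → ℝ, Continuous g ∧ Tendsto (timeMean g) atTop (𝓝 0) ∧
      ∀ t, f t ≤ g t + ε) :
    Tendsto (timeMean f) atTop (𝓝 0) := by
  rw [Metric.tendsto_nhds]
  intro ε hε
  obtain ⟨g, hg, hg0, hfg⟩ := h (ε / 2) (half_pos hε)
  filter_upwards [eventually_gt_atTop 0, hg0.eventually_lt_const (half_pos hε)] with r hr hgr
  rw [Real.dist_0_eq_abs, abs_of_nonneg (timeMean_nonneg hf0 hr)]
  have := timeMean_mono hf (hg.add continuous_const) hfg hr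
  rw [show g + (fun _ => ε / 2) = fun t => g t + ε / 2 from rfl,
    timeMean_add hg continuous_const, Pi.add_apply, timeMean_const _ hr] at this
  linarith

/-- Time means of a bounded function converge along every ultrafilter. -/
lemma exists_tendsto_timeMean [ProperSpace E] (𝒰 : Ultrafilter ℝ) (h𝒰 : (𝒰 : Filter ℝ) ≤ atTop)
    {f : ℝ → E} {M : ℝ} (hM : ∀ t, ‖f t‖ ≤ M) : ∃ c, Tendsto (timeMean f) 𝒰 (𝓝 c) := by
  have hmem : Metric.closedBall (0 : E) M ∈ 𝒰.map (timeMean f) := by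
    refine h𝒰 ?_
    filter_upwards [eventually_gt_atTop 0] with r hr
    simpa using norm_timeMean_le hM hr
  obtain ⟨c, -, hc⟩ := (isCompact_closedBall (0 : E) M).ultrafilter_le_nhds
    (𝒰.map (timeMean f)) (le_principal_iff.2 hmem)
  exact ⟨c, hc⟩

end TimeMean

section LimitOperator

variable {H : Type*} [NormedAddCommGroup H] [InnerProductSpace ℂ H]

lemma norm_inner_mul_inner_le {M : ℝ} {u : H} (hu : ‖u‖ ≤ M) (x y : H) :
    ‖inner ℂ x u * inner ℂ u y‖ ≤ M ^ 2 * ‖x‖ * ‖y‖ := by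
  rw [norm_mul]
  calc _ ≤ (‖x‖ * ‖u‖) * (‖u‖ * ‖y‖) := by gcongr <;> exact norm_inner_le_norm _ _
    _ = ‖u‖ ^ 2 * ‖x‖ * ‖y‖ := by ring
    _ ≤ _ := by gcongr

variable [CompleteSpace H]

/-- Weak limit, along an ultrafilter, of the time means of the rank one operators
`x ↦ ⟪u t, x⟫ • u t`. -/
lemma exists_weakLimit_rankOne (𝒰 : Ultrafilter ℝ) (h𝒰 : (𝒰 : Filter ℝ) ≤ atTop) {u : ℝ → H}
    (hu : Continuous u) {M : ℝ} (hM : ∀ t, ‖u t‖ ≤ M) :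
    ∃ A : H →L[ℂ] H, ∀ x y,
      Tendsto (timeMean fun t => inner ℂ x (u t) * inner ℂ (u t) y) 𝒰 (𝓝 (inner ℂ (A x) y)) := by
  have hcont : ∀ x y : H, Continuous fun t => inner ℂ x (u t) * inner ℂ (u t) y := by
    intro x y; fun_prop
  choose a ha using fun x y : H => exists_tendsto_timeMean 𝒰 h𝒰
    (fun t => norm_inner_mul_inner_le (hM t) x y)
  have hpos : ∀ᶠ r in (𝒰 : Filter ℝ), (0 : ℝ) < r := h𝒰 (eventually_gt_atTop 0)
  let B : H →ₗ⋆[ℂ] H →ₗ[ℂ] ℂ := LinearMap.mk₂'ₛₗ (starRingEnd ℂ) (RingHom.id ℂ) a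
    (fun x x' y => tendsto_nhds_unique (ha _ _) <| by
      simp only [inner_add_left, add_mul]
      rw [timeMean_add (hcont _ _) (hcont _ _)]
      exact (ha x y).add (ha x' y))
    (fun c x y => tendsto_nhds_unique (ha _ _) <| by
      simp only [inner_smul_left, mul_assoc]
      simp only [← smul_eq_mul (starRingEnd ℂ c)]
      rw [timeMean_smul]
      exact (ha x y).const_smul ((starRingEnd ℂ) c))
    (fun x y y' => tendsto_nhds_unique (ha _ _) <| by
      simp only [inner_add_right, mul_add]
      rw [timeMean_add (hcont _ _) (hcont _ _)]
      exact (ha x y).add (ha x y'))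
    (fun c x y => tendsto_nhds_unique (ha _ _) <| by
      simp only [inner_smul_right, mul_left_comm _ c]
      simp only [← smul_eq_mul c]
      rw [timeMean_smul]
      exact (ha x y).const_smul c)
  have hB : ∀ x y, ‖B x y‖ ≤ M ^ 2 * ‖x‖ * ‖y‖ := fun x y =>
    le_of_tendsto (ha x y).norm <| by
      filter_upwards [hpos] with r hr
      exact norm_timeMean_le (fun t => norm_inner_mul_inner_le (hM t) x y) hr
  refine ⟨InnerProductSpace.continuousLinearMapOfBilin (B.mkContinuous₂ _ hB), fun x y => ?_⟩
  rw [InnerProductSpace.continuousLinearMapOfBilin_apply]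
  exact ha x y

/-- A positive operator whose traces over finite orthonormal sets are bounded is compact. -/
lemma isCompactOperator_of_isPositive_of_sum_le {A : H →L[ℂ] H} (hA : A.IsPositive) {M : ℝ}
    (hM : ∀ F : Finset H, Orthonormal ℂ (fun e : (F : Set H) => (e : H)) →
      ∑ e ∈ F, (inner ℂ (A e) e).re ≤ M) : IsCompactOperator A := by
  classical
  let S : Set ℝ := {c | ∃ F : Finset H, Orthonormal ℂ (fun e : (F : Set H) => (e : H)) ∧
    ∑ e ∈ F, (inner ℂ (A e) e).re = c}
  have hS : BddAbove S := ⟨M, by rintro _ ⟨F, hF, rfl⟩; exact hM F hF⟩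
  have hS0 : S.Nonempty := ⟨0, ∅, by simp, by simp⟩
  refine isClosed_setOfPred_isCompactOperator.closure_subset (Metric.mem_closure_iff.2 ?_)
  intro ε hε
  obtain ⟨_, ⟨F, hF, rfl⟩, hFε⟩ := exists_lt_of_lt_csSup hS0 (sub_lt_self (sSup S) (half_pos hε))
  let K : Submodule ℂ H := Submodule.span ℂ (F : Set H)
  have : FiniteDimensional ℂ K := FiniteDimensional.span_finset ℂ F
  let Q : H →L[ℂ] H := K.starProjection
  let P : H →L[ℂ] H := Kᗮ.starProjection
  have hQ : IsCompactOperator Q :=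
    ((isCompactOperator_id_iff_finiteDimensional (𝕜 := ℂ)).2 this).comp_clm
      K.orthogonalProjectionOnto |>.clm_comp K.subtypeL
  have hunit : ∀ x ∈ Kᗮ, ‖x‖ = 1 → (inner ℂ (A x) x).re ≤ ε / 2 := by
    intro x hx hx1
    have hxF : ∀ e ∈ F, inner ℂ e x = 0 := fun e he => hx e (Submodule.subset_span he)
    have hxnot : x ∉ F := fun h => by
      have := hxF x h
      simp_all
    have := le_csSup hS ⟨insert x F, ?_, rfl⟩
    · rw [Finset.sum_insert hxnot] at this
      linarith
    · rw [orthonormal_subtype_iff_ite] at hF ⊢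
      simp only [Finset.coe_insert, Set.mem_insert_iff, Finset.mem_coe] at hF ⊢
      rintro v (rfl | hv) w (rfl | hw)
      · simp [hx1]
      · rw [if_neg (by rintro rfl; exact hxnot hw), ← inner_conj_symm, hxF w hw, map_zero]
      · rw [if_neg (by rintro rfl; exact hxnot hv), hxF v hv]
      · exact hF v hv w hw
  have hquad : ∀ x ∈ Kᗮ, (inner ℂ (A x) x).re ≤ ε / 2 * ‖x‖ ^ 2 := by
    intro x hx
    rcases eq_or_ne x 0 with rfl | hx0
    · simp
    have hn : ‖x‖ ≠ 0 := norm_ne_zero_iff.2 hx0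
    have := hunit (((‖x‖⁻¹ : ℝ) : ℂ) • x) (Kᗮ.smul_mem _ hx) (by
      rw [norm_smul, Complex.norm_real, norm_inv, norm_norm, inv_mul_cancel₀ hn])
    rw [map_smul, inner_smul_left, inner_smul_right, Complex.conj_ofReal, Complex.re_ofReal_mul,
      Complex.re_ofReal_mul] at this
    calc _ = (‖x‖⁻¹ * (‖x‖⁻¹ * (inner ℂ (A x) x).re)) * ‖x‖ ^ 2 := by field_simp
      _ ≤ _ := by gcongr
  have hPsymm : ∀ x y, inner ℂ (P x) y = inner ℂ x (P y) :=
    fun x y => Submodule.inner_starProjection_left_eq_right _ _ _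
  have hPAPsymm : (P * A * P).IsSymmetric := fun x y => by
    change inner ℂ (P (A (P x))) y = inner ℂ x (P (A (P y)))
    rw [hPsymm, ← hPsymm x]
    exact hA.isSymmetric _ _
  have hPAP : ‖P * A * P‖ ≤ ε / 2 := by
    rw [ContinuousLinearMap.norm_eq_iSup_rayleighQuotient _ hPAPsymm]
    refine ciSup_le fun x => ?_
    have hre : (P * A * P).reApplyInnerSelf x = (inner ℂ (A (P x)) (P x)).re := by
      rw [ContinuousLinearMap.reApplyInnerSelf_apply]
      exact congrArg Complex.re (hPsymm _ _)
    have h0 : 0 ≤ (inner ℂ (A (P x)) (P x)).re := hA.re_inner_nonneg_left _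
    have h1 := hquad (P x) (Submodule.starProjection_apply_mem _ _)
    have h2 : ‖P x‖ ≤ ‖x‖ := Submodule.norm_starProjection_apply_le _ _
    rw [ContinuousLinearMap.rayleighQuotient, hre, abs_of_nonneg (by positivity)]
    refine div_le_of_le_mul₀ (by positivity) (by positivity) (h1.trans ?_)
    gcongr
  refine ⟨A - P * A * P, ?_, ?_⟩
  · have hPQ : ∀ x, P x = x - Q x := fun x => by
      simp [P, Q, Submodule.starProjection_orthogonal]
    have : A - P * A * P = A * Q + Q * (A * P) := by
      ext x
      simp [hPQ]
      abel
    rw [this]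
    exact (hQ.clm_comp A).add (hQ.comp_clm (A * P))
  · rw [dist_eq_norm, sub_sub_cancel]
    linarith


/-- If `u` is bounded and asymptotically weakly null in quadratic time mean, then a compact
operator maps it to a function asymptotically null in quadratic time mean. -/
lemma tendsto_timeMean_norm_sq_of_isCompactOperator {u : ℝ → H} (hu : Continuous u) {M : ℝ}
    (hM : ∀ t, ‖u t‖ ≤ M)
    (hweak : ∀ x, Tendsto (timeMean fun t => ‖inner ℂ x (u t)‖ ^ 2) atTop (𝓝 0))
    {K : H →L[ℂ] H} (hK : IsCompactOperator K) :
    Tendsto (timeMean fun t => ‖K (u t)‖ ^ 2) atTop (𝓝 0) := by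
  have hM0 : 0 ≤ M := (norm_nonneg _).trans (hM 0)
  refine tendsto_timeMean_zero_of_forall_le_add (by fun_prop) (fun t => by positivity) ?_
  intro ε hε
  obtain ⟨S, hS, hKS⟩ := IsCompactOperator.image_closedBall_subset_compact
    (f := (K : H →ₗ[ℂ] H)) hK M
  obtain ⟨F, -, hF, hSF⟩ := hS.finite_cover_balls
    (show 0 < ε / (2 * (‖K‖ * M + 1)) by positivity)
  lift F to Finset H using hF
  have hcont : ∀ y, Continuous fun t => (2 * ε)⁻¹ • ‖inner ℂ (K.adjoint y) (u t)‖ ^ 2 := by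
    intro y; fun_prop
  refine ⟨fun t => ∑ y ∈ F, (2 * ε)⁻¹ • ‖inner ℂ (K.adjoint y) (u t)‖ ^ 2,
    continuous_finsetSum _ fun y _ => hcont y, ?_, fun t => ?_⟩
  · have : timeMean (fun t => ∑ y ∈ F, (2 * ε)⁻¹ • ‖inner ℂ (K.adjoint y) (u t)‖ ^ 2) =
        fun r => ∑ y ∈ F,
          (2 * ε)⁻¹ • timeMean (fun t => ‖inner ℂ (K.adjoint y) (u t)‖ ^ 2) r := by
      ext r
      rw [timeMean_finsetSum _ fun y _ => hcont y]
      simp only [timeMean_smul, Pi.smul_apply]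
    rw [this]
    simpa using tendsto_finsetSum F fun y _ => (hweak (K.adjoint y)).const_smul (2 * ε)⁻¹
  · have hmem : K (u t) ∈ S := hKS ⟨u t, by simpa using hM t, rfl⟩
    obtain ⟨y, hy, hyK⟩ := Set.mem_iUnion₂.1 (hSF hmem)
    rw [Metric.mem_ball, dist_eq_norm] at hyK
    have hKu : ‖K (u t)‖ ≤ ‖K‖ * M := (K.le_opNorm _).trans (by gcongr; exact hM t)
    have hsingle : (2 * ε)⁻¹ • ‖inner ℂ (K.adjoint y) (u t)‖ ^ 2 ≤
        ∑ y ∈ F, (2 * ε)⁻¹ • ‖inner ℂ (K.adjoint y) (u t)‖ ^ 2 :=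
      Finset.single_le_sum (f := fun y => (2 * ε)⁻¹ • ‖inner ℂ (K.adjoint y) (u t)‖ ^ 2)
        (fun y _ => by positivity) hy
    refine le_trans ?_ (add_le_add_left hsingle ε)
    rw [ContinuousLinearMap.adjoint_inner_left, smul_eq_mul]
    set z : ℂ := inner ℂ y (K (u t))
    have hsplit : ‖K (u t)‖ ^ 2 = ‖z + inner ℂ (K (u t) - y) (K (u t))‖ := by
      rw [inner_sub_left, add_sub_cancel, inner_self_eq_norm_sq_to_K]
      simp
    have hsmall : ‖inner ℂ (K (u t) - y) (K (u t))‖ ≤ ε / 2 :=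
      calc _ ≤ ‖K (u t) - y‖ * ‖K (u t)‖ := norm_inner_le_norm _ _
        _ ≤ ε / (2 * (‖K‖ * M + 1)) * (‖K‖ * M + 1) := by
          gcongr
          linarith
        _ = ε / 2 := by field_simp
    have hamgm : ‖z‖ ≤ (2 * ε)⁻¹ * ‖z‖ ^ 2 + ε / 2 := by
      have : 0 ≤ (2 * ε)⁻¹ * (‖z‖ - ε) ^ 2 := by positivity
      have heq : (2 * ε)⁻¹ * (‖z‖ - ε) ^ 2 = (2 * ε)⁻¹ * ‖z‖ ^ 2 + ε / 2 - ‖z‖ := by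
        field_simp
        ring
      linarith
    rw [hsplit]
    linarith [norm_add_le z (inner ℂ (K (u t) - y) (K (u t)))]

end LimitOperator

section UnitaryGroup

variable {H : Type*} [NormedAddCommGroup H] [InnerProductSpace ℂ H]
  {T : H →ₗ.[ℂ] H} {U : ℝ → (H ≃ₗᵢ[ℂ] H)} {R : H →L[ℂ] H}

lemma continuous_unitaryGroup_apply (hdense : Dense (T.domain : Set H))
    (hgen : ∀ (x : T.domain) (t : ℝ),
      HasDerivAt (fun s : ℝ => U s (x : H)) ((-Complex.I) • U t (T x)) t) (Φ : H) :
    Continuous fun t => U t Φ := by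
  refine continuous_of_uniform_approx_of_continuous fun V hV => ?_
  obtain ⟨ε, hε, hεV⟩ := Metric.mem_uniformity_dist.1 hV
  obtain ⟨x, hx, hxΦ⟩ := hdense.exists_dist_lt Φ hε
  refine ⟨fun t => U t x, continuous_iff_continuousAt.2 fun t => (hgen ⟨x, hx⟩ t).continuousAt,
    fun t => hεV ?_⟩
  rwa [(U t).dist_map]

variable [CompleteSpace H]

lemma IsSelfAdjoint.isFormalAdjoint (hsa : IsSelfAdjoint T) : T.IsFormalAdjoint T := by
  have h := LinearPMap.adjoint_isFormalAdjoint hsa.dense_domain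
  rwa [LinearPMap.isSelfAdjoint_def.1 hsa] at h

lemma IsSelfAdjoint.exists_mem_domain_of_inner_eq (hsa : IsSelfAdjoint T) {z w : H}
    (h : ∀ y : T.domain, inner ℂ w (y : H) = inner ℂ z (T y)) :
    ∃ hz : z ∈ T.domain, T ⟨z, hz⟩ = w := by
  have hadj : T.adjoint = T := LinearPMap.isSelfAdjoint_def.1 hsa
  have hz : z ∈ T.adjoint.domain := LinearPMap.mem_adjoint_domain_of_exists z ⟨w, h⟩
  have hTz : T.adjoint ⟨z, hz⟩ = w := LinearPMap.adjoint_apply_eq hsa.dense_domain _ h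
  revert hz
  rw [hadj]
  exact fun hz hTz => ⟨hz, hTz⟩

/-- The eigenvalues of a self-adjoint operator are real. -/
lemma IsSelfAdjoint.eq_zero_or_conj_eq (hsa : IsSelfAdjoint T) {c : ℂ} {x : T.domain}
    (hx : T x = c • (x : H)) : (x : H) = 0 ∨ (starRingEnd ℂ) c = c := by
  have h := hsa.isFormalAdjoint x x
  rw [hx, inner_smul_left, inner_smul_right] at h
  exact (mul_eq_mul_right_iff.1 h).symm.imp_left inner_self_eq_zero.1

lemma IsSelfAdjoint.resolvent_eq (hsa : IsSelfAdjoint T)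
    (hR : ∀ y : H, ∃ hy : R y ∈ T.domain, T ⟨R y, hy⟩ + Complex.I • R y = y)
    (x : T.domain) : R (T x + Complex.I • (x : H)) = x := by
  obtain ⟨hy, hyR⟩ := hR (T x + Complex.I • (x : H))
  set y := T x + Complex.I • (x : H)
  have hz : T (⟨R y, hy⟩ - x) = (-Complex.I) • ((⟨R y, hy⟩ - x : T.domain) : H) := by
    rw [LinearPMap.map_sub, eq_sub_of_add_eq hyR, Submodule.coe_sub]
    simp only [y]
    module
  rcases hsa.eq_zero_or_conj_eq hz with h | h
  · exact sub_eq_zero.1 h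
  · norm_num [Complex.ext_iff] at h

/-- A self-adjoint operator without eigenvalues has no nonzero finite-dimensional subspace
invariant under its resolvent. -/
lemma IsSelfAdjoint.eq_bot_of_forall_resolvent_mem (hsa : IsSelfAdjoint T)
    (hnoeig : ∀ (μ : ℝ) (x : T.domain), T x = (μ : ℂ) • (x : H) → (x : H) = 0)
    (hR : ∀ y : H, ∃ hy : R y ∈ T.domain, T ⟨R y, hy⟩ + Complex.I • R y = y)
    (E : Submodule ℂ H) [FiniteDimensional ℂ E] (hE : ∀ x ∈ E, R x ∈ E) : E = ⊥ := by
  by_contra hne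
  have : Nontrivial E := Submodule.nontrivial_iff_ne_bot.2 hne
  obtain ⟨ν, hν⟩ := Module.End.exists_eigenvalue ((R : H →ₗ[ℂ] H).restrict hE)
  obtain ⟨⟨v, hvE⟩, hv⟩ := hν.exists_hasEigenvector
  have hv0 : v ≠ 0 := fun h => hv.2 (Subtype.ext h)
  have hRv : R v = ν • v := congrArg Subtype.val hv.apply_eq_smul
  obtain ⟨hdom, hTR⟩ := hR v
  have hν0 : ν ≠ 0 := by
    rintro rfl
    rw [zero_smul] at hRv
    have h0 : (⟨R v, hdom⟩ : T.domain) = 0 := Subtype.ext hRv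
    rw [h0, hRv, LinearPMap.map_zero, smul_zero, add_zero] at hTR
    exact hv0 hTR.symm
  have hTv : T ⟨R v, hdom⟩ = (ν⁻¹ - Complex.I) • ((⟨R v, hdom⟩ : T.domain) : H) := by
    have hv' : ν⁻¹ • R v = v := by rw [hRv, inv_smul_smul₀ hν0]
    change _ = (ν⁻¹ - Complex.I) • R v
    rw [eq_sub_of_add_eq hTR, sub_smul, hv']
  have hRv0 : R v ≠ 0 := hRv ▸ smul_ne_zero hν0 hv0
  obtain ⟨μ, hμ⟩ := Complex.conj_eq_iff_real.1
    ((hsa.eq_zero_or_conj_eq hTv).resolve_left hRv0)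
  exact hRv0 (hnoeig μ _ (hμ ▸ hTv))

/-- The infinitesimal generator of the unitary group has no domain beyond that of `T`. -/
lemma IsSelfAdjoint.exists_mem_domain_of_hasDerivAt (hsa : IsSelfAdjoint T)
    (hU0 : U 0 = LinearIsometryEquiv.refl ℂ H)
    (hgen : ∀ (x : T.domain) (t : ℝ),
      HasDerivAt (fun s : ℝ => U s (x : H)) ((-Complex.I) • U t (T x)) t)
    {z w : H} (h : HasDerivAt (fun s => U s z) ((-Complex.I) • w) 0) :
    ∃ hz : z ∈ T.domain, T ⟨z, hz⟩ = w := by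
  refine hsa.exists_mem_domain_of_inner_eq fun y => ?_
  have h1 := h.inner ℂ (hgen y 0)
  simp only [LinearIsometryEquiv.inner_map_map, hU0, LinearIsometryEquiv.coe_refl, id_eq] at h1
  have h2 := h1.unique (hasDerivAt_const _ _)
  rw [inner_smul_left, inner_smul_right] at h2
  simp only [map_neg, Complex.conj_I, neg_neg] at h2
  refine mul_left_cancel₀ Complex.I_ne_zero ?_
  linear_combination h2

lemma IsSelfAdjoint.exists_unitaryGroup_apply_mem_domain (hsa : IsSelfAdjoint T)
    (hU0 : U 0 = LinearIsometryEquiv.refl ℂ H)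
    (hgrp : ∀ s t : ℝ, U (s + t) = (U s).trans (U t))
    (hgen : ∀ (x : T.domain) (t : ℝ),
      HasDerivAt (fun s : ℝ => U s (x : H)) ((-Complex.I) • U t (T x)) t)
    (x : T.domain) (t : ℝ) :
    ∃ hx : U t (x : H) ∈ T.domain, T ⟨U t x, hx⟩ = U t (T x) := by
  refine hsa.exists_mem_domain_of_hasDerivAt hU0 hgen ?_
  have h : HasDerivAt (fun s : ℝ => U s (x : H)) ((-Complex.I) • U t (T x)) (t + 0) := by
    simpa using hgen x t
  simpa only [hgrp, LinearIsometryEquiv.trans_apply] using h.comp_const_add t 0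

/-- A bounded operator commuting with the unitary group commutes with the resolvent. -/
lemma IsSelfAdjoint.apply_resolvent_of_commute (hsa : IsSelfAdjoint T)
    (hU0 : U 0 = LinearIsometryEquiv.refl ℂ H)
    (hgen : ∀ (x : T.domain) (t : ℝ),
      HasDerivAt (fun s : ℝ => U s (x : H)) ((-Complex.I) • U t (T x)) t)
    (hR : ∀ y : H, ∃ hy : R y ∈ T.domain, T ⟨R y, hy⟩ + Complex.I • R y = y)
    {A : H →L[ℂ] H} (hA : ∀ s x, A (U s x) = U s (A x)) (y : H) : A (R y) = R (A y) := by
  obtain ⟨hy, hTy⟩ := hR y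
  have h := (A.restrictScalars ℝ).hasFDerivAt.comp_hasDerivAt (0 : ℝ) (hgen ⟨R y, hy⟩ 0)
  obtain ⟨hAy, hTAy⟩ := hsa.exists_mem_domain_of_hasDerivAt hU0 hgen
    (z := A (R y)) (w := A (T ⟨R y, hy⟩)) (by
      convert! h using 1
      · ext s; exact (hA s _).symm
      · simp [hU0])
  have hres := hsa.resolvent_eq hR ⟨A (R y), hAy⟩
  rw [hTAy, ← map_smul A, ← map_add A, hTy] at hres
  exact hres.symm

/-- Continuous version of **Wiener's theorem**: matrix elements of the unitary group generated by
an operator without eigenvalues vanish asymptotically in quadratic time mean. -/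
lemma IsSelfAdjoint.tendsto_timeMean_norm_inner_sq (hsa : IsSelfAdjoint T)
    (hnoeig : ∀ (μ : ℝ) (x : T.domain), T x = (μ : ℂ) • (x : H) → (x : H) = 0)
    (hU0 : U 0 = LinearIsometryEquiv.refl ℂ H)
    (hgrp : ∀ s t : ℝ, U (s + t) = (U s).trans (U t))
    (hgen : ∀ (x : T.domain) (t : ℝ),
      HasDerivAt (fun s : ℝ => U s (x : H)) ((-Complex.I) • U t (T x)) t)
    (hR : ∀ y : H, ∃ hy : R y ∈ T.domain, T ⟨R y, hy⟩ + Complex.I • R y = y) (Φ x : H) :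
    Tendsto (timeMean fun t => ‖inner ℂ x (U t Φ)‖ ^ 2) atTop (𝓝 0) := by
  rw [tendsto_iff_ultrafilter]
  intro 𝒰 h𝒰
  have hu := continuous_unitaryGroup_apply hsa.dense_domain hgen Φ
  have hbound : ∀ t, ‖U t Φ‖ ≤ ‖Φ‖ := fun t => ((U t).norm_map Φ).le
  have hpos : ∀ᶠ r in (𝒰 : Filter ℝ), (0 : ℝ) < r := h𝒰 (eventually_gt_atTop 0)
  obtain ⟨A, hA⟩ := exists_weakLimit_rankOne 𝒰 h𝒰 hu hbound
  have hdiag : ∀ x, Tendsto (timeMean fun t => ‖inner ℂ x (U t Φ)‖ ^ 2) 𝒰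
      (𝓝 (inner ℂ (A x) x).re) := by
    intro x
    have h := (Complex.continuous_re.tendsto _).comp (hA x x)
    refine h.congr fun r => ?_
    have : (fun t => inner ℂ x (U t Φ) * inner ℂ (U t Φ) x) =
        fun t => ((‖inner ℂ x (U t Φ)‖ ^ 2 : ℝ) : ℂ) := by
      ext t
      rw [← inner_conj_symm (U t Φ) x, Complex.mul_conj, Complex.normSq_eq_norm_sq]
    rw [Function.comp_apply, this, timeMean_ofReal, Complex.ofReal_re]
  have hsymm : A.IsSymmetric := fun x y => by
    have h := (Complex.continuous_conj.tendsto _).comp (hA y x)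
    rw [inner_conj_symm] at h
    refine tendsto_nhds_unique (hA x y) (h.congr fun r => ?_)
    simp only [Function.comp_apply, timeMean]
    rw [Complex.real_smul, Complex.real_smul, map_mul, Complex.conj_ofReal,
      ← intervalIntegral.intervalIntegral_conj]
    simp [mul_comm]
  have hApos : A.IsPositive := ⟨hsymm, fun x => by
    rw [ContinuousLinearMap.reApplyInnerSelf_apply]
    refine ge_of_tendsto (hdiag x) ?_
    filter_upwards [hpos] with r hr
    exact timeMean_nonneg (fun t => by positivity) hr⟩
  have hAcpt : IsCompactOperator A := by
    refine isCompactOperator_of_isPositive_of_sum_le hApos (M := ‖Φ‖ ^ 2) fun F hF => ?_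
    refine le_of_tendsto (tendsto_finsetSum F fun e _ => hdiag e) ?_
    filter_upwards [hpos] with r hr
    have hcont : ∀ e : H, Continuous fun t => ‖inner ℂ e (U t Φ)‖ ^ 2 := by
      intro e; fun_prop
    rw [← timeMean_finsetSum F fun e _ => hcont e, ← timeMean_const (‖Φ‖ ^ 2) hr]
    refine timeMean_mono (continuous_finsetSum _ fun e _ => hcont e) continuous_const
      (fun t => ?_) hr
    have h := hF.sum_inner_products_le (U t Φ) (s := Finset.univ)
    rw [(U t).norm_map] at h
    refine le_trans (le_of_eq ?_) h
    exact (Finset.sum_coe_sort F fun e => ‖inner ℂ e (U t Φ)‖ ^ 2).symm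
  have hAU : ∀ s x, A (U s x) = U s (A x) := by
    intro s x
    refine ext_inner_right ℂ fun y => ?_
    obtain ⟨y, rfl⟩ := (U s).surjective y
    rw [(U s).inner_map_map]
    have h := tendsto_timeMean_comp_add_sub
      (f := fun t => inner ℂ (U s x) (U t Φ) * inner ℂ (U t Φ) (U s y)) (by fun_prop)
      (fun t => norm_inner_mul_inner_le (hbound t) _ _) s
    have heq : (fun t => inner ℂ (U s x) (U (t + s) Φ) * inner ℂ (U (t + s) Φ) (U s y)) =
        fun t => inner ℂ x (U t Φ) * inner ℂ (U t Φ) y := by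
      ext t
      simp only [hgrp, LinearIsometryEquiv.trans_apply, LinearIsometryEquiv.inner_map_map]
    rw [heq] at h
    have h' := tendsto_nhds_unique ((hA x y).sub (hA (U s x) (U s y))) (h.mono_left h𝒰)
    exact (sub_eq_zero.1 h').symm
  have hA0 : A = 0 := by
    refine (ContinuousLinearMap.eq_zero_of_forall_hasEigenvalue_eq_zero hAcpt hsymm).1 ?_
    intro μ hμ
    by_contra hμ0
    have := ContinuousLinearMap.finite_dimensional_eigenspace hAcpt μ hμ0
    refine hμ (hsa.eq_bot_of_forall_resolvent_mem hnoeig hR _ fun x hx => ?_)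
    rw [Module.End.mem_eigenspace_iff] at hx ⊢
    change A (R x) = μ • R x
    rw [hsa.apply_resolvent_of_commute hU0 hgen hR hAU, show A x = μ • x from hx, map_smul]
  simpa [hA0] using hdiag x

end UnitaryGroup

/-- RAGE theorem (continuous-spectrum case): if `T` is self-adjoint with no eigenvalues,
`U(t) = exp(−itT)` its unitary group, and `C` a bounded operator such that `C(T+i)⁻¹` is
compact, then the time mean `(1/(2T₀))∫_{−T₀}^{T₀} ‖C e^{−itT}Φ‖² dt` tends to `0` as
`T₀ → ∞`, for every `Φ`. -/
theorem stmt_16 {H : Type*} [NormedAddCommGroup H] [InnerProductSpace ℂ H] [CompleteSpace H]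
    (T : H →ₗ.[ℂ] H) (hsa : IsSelfAdjoint T)
    (hnoeig : ∀ (μ : ℝ) (x : T.domain), T x = (μ : ℂ) • (x : H) → (x : H) = 0)
    (U : ℝ → (H ≃ₗᵢ[ℂ] H))
    (hU0 : U 0 = LinearIsometryEquiv.refl ℂ H)
    (hgrp : ∀ s t : ℝ, U (s + t) = (U s).trans (U t))
    (hgen : ∀ (x : T.domain) (t : ℝ),
      HasDerivAt (fun s : ℝ => U s (x : H)) ((-Complex.I) • U t (T x)) t)
    (C : H →L[ℂ] H) (R : H →L[ℂ] H)
    (hR : ∀ y : H, ∃ hy : R y ∈ T.domain, T ⟨R y, hy⟩ + Complex.I • R y = y)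
    (hcpt : IsCompactOperator (C.comp R)) :
    ∀ Φ : H,
      Tendsto (fun T₀ : ℝ => (1 / (2 * T₀)) * ∫ t in (-T₀)..T₀, ‖C (U t Φ)‖ ^ 2)
        atTop (𝓝 0) := by
  intro Φ
  have hu := continuous_unitaryGroup_apply hsa.dense_domain hgen
  change Tendsto (timeMean fun t => ‖C (U t Φ)‖ ^ 2) atTop (𝓝 0)
  refine tendsto_timeMean_zero_of_forall_le_add (by fun_prop) (fun t => by positivity) ?_
  intro ε hε
  obtain ⟨φ, hφ, hφΦ⟩ := hsa.dense_domain.exists_dist_lt Φ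
    (show 0 < √(ε / 2) / (‖C‖ + 1) by positivity)
  let ψ : H := T ⟨φ, hφ⟩ + Complex.I • φ
  have hRψ : ∀ t, R (U t ψ) = U t φ := by
    intro t
    obtain ⟨hmem, hT⟩ :=
      hsa.exists_unitaryGroup_apply_mem_domain hU0 hgrp hgen ⟨φ, hφ⟩ t
    have h := hsa.resolvent_eq hR ⟨U t φ, hmem⟩
    rwa [hT, ← map_smul, ← map_add] at h
  have hψ := tendsto_timeMean_norm_sq_of_isCompactOperator (hu ψ)
    (fun t => ((U t).norm_map ψ).le)
    (hsa.tendsto_timeMean_norm_inner_sq hnoeig hU0 hgrp hgen hR ψ) hcpt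
  refine ⟨fun t => (2 : ℝ) • ‖C.comp R (U t ψ)‖ ^ 2, by fun_prop, ?_, fun t => ?_⟩
  · rw [timeMean_smul]
    simpa only [smul_zero] using! hψ.const_smul (2 : ℝ)
  · have hdiff : ‖C (U t (Φ - φ))‖ ≤ √(ε / 2) :=
      calc _ ≤ ‖C‖ * ‖Φ - φ‖ := by
            simpa only [(U t).norm_map] using C.le_opNorm (U t (Φ - φ))
        _ ≤ (‖C‖ + 1) * (√(ε / 2) / (‖C‖ + 1)) := by
            rw [← dist_eq_norm]
            gcongr
            linarith
        _ = √(ε / 2) := by field_simp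
    have hsq : ‖C (U t (Φ - φ))‖ ^ 2 ≤ ε / 2 :=
      (pow_le_pow_left₀ (norm_nonneg _) hdiff 2).trans_eq (Real.sq_sqrt (by positivity))
    have htri : ‖C (U t Φ)‖ ≤ ‖C (U t φ)‖ + ‖C (U t (Φ - φ))‖ := by
      have h := norm_add_le (C (U t φ)) (C (U t (Φ - φ)))
      rwa [← map_add, ← map_add, add_sub_cancel] at h
    simp only [ContinuousLinearMap.comp_apply, hRψ, smul_eq_mul]
    calc _ ≤ (‖C (U t φ)‖ + ‖C (U t (Φ - φ))‖) ^ 2 := by gcongr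
      _ ≤ 2 * (‖C (U t φ)‖ ^ 2 + ‖C (U t (Φ - φ))‖ ^ 2) := add_sq_le
      _ ≤ _ := by linarith
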